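/- arXiv:2209.09847 — 3 statements merged into one kernel-verified Lean document; each statement's English description precedes it below -/
import Mathlib

section
/- Let G be a finite two-player zero-sum game (u_2 = −u_1). Then a mixed strategy s_1 of player 1 solves player 1's Definition-4 problem if and only if s_1 is a maximin strategy for player 1; symmetrically, a mixed strategy s_2 of player 2 solves player 2's Definition-4 problem if and only if s_2 is a maximin strategy for player 2. -/
/-- A mixed strategy: nonnegative weights summing to one. -/
def IsMixed {α : Type*} [Fintype α] (s : α → ℝ) : Prop :=
  (∀ a, 0 ≤ s a) ∧ ∑ a, s a = 1

/-- Expected payoff in a two-player game with payoff function `u`. -/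
noncomputable def U {α β : Type*} [Fintype α] [Fintype β]
    (u : α → β → ℝ) (t₁ : α → ℝ) (t₂ : β → ℝ) : ℝ :=
  ∑ a, ∑ b, t₁ a * t₂ b * u a b

/-- `s₁` is a (mixed) best response of player 1 to `t₂`. -/
def IsBR1 {α β : Type*} [Fintype α] [Fintype β]
    (u₁ : α → β → ℝ) (s₁ : α → ℝ) (t₂ : β → ℝ) : Prop :=
  IsMixed s₁ ∧ ∀ t₁, IsMixed t₁ → U u₁ t₁ t₂ ≤ U u₁ s₁ t₂

/-- `s₂` is a (mixed) best response of player 2 to `t₁`. -/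
def IsBR2 {α β : Type*} [Fintype α] [Fintype β]
    (u₂ : α → β → ℝ) (t₁ : α → ℝ) (s₂ : β → ℝ) : Prop :=
  IsMixed s₂ ∧ ∀ t₂, IsMixed t₂ → U u₂ t₁ t₂ ≤ U u₂ t₁ s₂

/-- `s₁` solves player 1's Definition-4 problem: player 1 is rational assuming
player 2 is both rational and correct. -/
def Solves1 {α β : Type*} [Fintype α] [Fintype β]
    (u₁ u₂ : α → β → ℝ) (s₁ : α → ℝ) : Prop :=
  IsMixed s₁ ∧ ∃ t₂, IsBR2 u₂ s₁ t₂ ∧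
    ∀ t₁ t₂', IsMixed t₁ → IsBR2 u₂ t₁ t₂' → U u₁ t₁ t₂' ≤ U u₁ s₁ t₂

/-- `s₂` solves player 2's Definition-4 problem: player 2 is rational assuming
player 1 is both rational and correct. -/
def Solves2 {α β : Type*} [Fintype α] [Fintype β]
    (u₁ u₂ : α → β → ℝ) (s₂ : β → ℝ) : Prop :=
  IsMixed s₂ ∧ ∃ t₁, IsBR1 u₁ t₁ s₂ ∧
    ∀ t₂ t₁', IsMixed t₂ → IsBR1 u₁ t₁' t₂ → U u₂ t₁' t₂ ≤ U u₂ t₁ s₂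

/-- `s₁` is a maximin strategy for player 1. -/
def IsMaximin1 {α β : Type*} [Fintype α] [Fintype β]
    (u₁ : α → β → ℝ) (s₁ : α → ℝ) : Prop :=
  IsMixed s₁ ∧ ∀ t₁, IsMixed t₁ →
    sInf {x | ∃ t₂, IsMixed t₂ ∧ U u₁ t₁ t₂ = x} ≤
      sInf {x | ∃ t₂, IsMixed t₂ ∧ U u₁ s₁ t₂ = x}

/-- `s₂` is a maximin strategy for player 2. -/
def IsMaximin2 {α β : Type*} [Fintype α] [Fintype β]
    (u₂ : α → β → ℝ) (s₂ : β → ℝ) : Prop :=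
  IsMixed s₂ ∧ ∀ t₂, IsMixed t₂ →
    sInf {x | ∃ t₁, IsMixed t₁ ∧ U u₂ t₁ t₂ = x} ≤
      sInf {x | ∃ t₁, IsMixed t₁ ∧ U u₂ t₁ s₂ = x}

/-- The pure (Dirac) strategy on action `a`. -/
noncomputable def pureStrat {α : Type*} [DecidableEq α] (a : α) : α → ℝ :=
  fun b => if b = a then 1 else 0

theorem U_flip {α β : Type*} [Fintype α] [Fintype β]
    (u : α → β → ℝ) (t₁ : α → ℝ) (t₂ : β → ℝ) :
    U (fun b a => u a b) t₂ t₁ = U u t₁ t₂ := by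
  unfold U
  rw [Finset.sum_comm]
  simp only [mul_comm (t₂ _)]

theorem U_eq_neg {α β : Type*} [Fintype α] [Fintype β]
    {u₁ u₂ : α → β → ℝ} (hzs : ∀ a b, u₂ a b = -u₁ a b) (t₁ : α → ℝ) (t₂ : β → ℝ) :
    U u₂ t₁ t₂ = -U u₁ t₁ t₂ := by
  simp [U, hzs]

theorem exists_isBR2 {α β : Type*} [Fintype α] [Fintype β] [Nonempty β]
    (u₂ : α → β → ℝ) (t₁ : α → ℝ) : ∃ t₂, IsBR2 u₂ t₁ t₂ := by
  classical
  have hne : (stdSimplex ℝ β).Nonempty := ⟨_, single_mem_stdSimplex ℝ (Classical.arbitrary β)⟩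
  have hcont : Continuous (U u₂ t₁) := by
    unfold U
    fun_prop
  obtain ⟨t₂, ht₂, hmax⟩ :=
    (isCompact_stdSimplex ℝ β).exists_isMaxOn hne hcont.continuousOn
  exact ⟨t₂, ht₂, fun t ht => hmax ht⟩

/-- In a zero-sum game a best reply of player 2 attains player 1's worst-case payoff. -/
theorem IsBR2.sInf_eq {α β : Type*} [Fintype α] [Fintype β]
    {u₁ u₂ : α → β → ℝ} (hzs : ∀ a b, u₂ a b = -u₁ a b) {t₁ : α → ℝ} {t₂ : β → ℝ}
    (h : IsBR2 u₂ t₁ t₂) :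
    sInf {x | ∃ t, IsMixed t ∧ U u₁ t₁ t = x} = U u₁ t₁ t₂ := by
  refine IsLeast.csInf_eq ⟨⟨t₂, h.1, rfl⟩, ?_⟩
  rintro _ ⟨t, ht, rfl⟩
  have := h.2 t ht
  rw [U_eq_neg hzs, U_eq_neg hzs] at this
  linarith

theorem solves1_iff_isMaximin1 {α β : Type*} [Fintype α] [Fintype β] [Nonempty β]
    {u₁ u₂ : α → β → ℝ} (hzs : ∀ a b, u₂ a b = -u₁ a b) (s₁ : α → ℝ) :
    Solves1 u₁ u₂ s₁ ↔ IsMaximin1 u₁ s₁ := by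
  refine and_congr_right fun _ => ⟨?_, fun h => ?_⟩
  · rintro ⟨t₂, hbr, hopt⟩ t₁ ht₁
    obtain ⟨t, ht⟩ := exists_isBR2 u₂ t₁
    rw [ht.sInf_eq hzs, hbr.sInf_eq hzs]
    exact hopt t₁ t ht₁ ht
  · obtain ⟨t₂, hbr⟩ := exists_isBR2 u₂ s₁
    refine ⟨t₂, hbr, fun t₁ t ht₁ ht => ?_⟩
    rw [← ht.sInf_eq hzs, ← hbr.sInf_eq hzs]
    exact h t₁ ht₁

theorem solves2_iff_isMaximin2 {α β : Type*} [Fintype α] [Fintype β] [Nonempty α]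
    {u₁ u₂ : α → β → ℝ} (hzs : ∀ a b, u₂ a b = -u₁ a b) (s₂ : β → ℝ) :
    Solves2 u₁ u₂ s₂ ↔ IsMaximin2 u₂ s₂ := by
  have h := solves1_iff_isMaximin1 (u₁ := fun b a => u₂ a b) (u₂ := fun b a => u₁ a b)
    (fun b a => by simp [hzs]) s₂
  simpa only [Solves1, Solves2, IsMaximin1, IsMaximin2, IsBR1, IsBR2, U_flip] using h

/-- In a finite two-player zero-sum game, a mixed strategy solves a player's
Definition-4 problem (the player is rational assuming the opponent is both rational
and correct) if and only if it is a maximin strategy for that player. -/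
theorem def4_iff_maximin_zero_sum
    {α β : Type*} [Fintype α] [Fintype β] [Nonempty α] [Nonempty β]
    (u₁ u₂ : α → β → ℝ) (hzs : ∀ a b, u₂ a b = -u₁ a b) :
    (∀ s₁, IsMixed s₁ → (Solves1 u₁ u₂ s₁ ↔ IsMaximin1 u₁ s₁)) ∧
    (∀ s₂, IsMixed s₂ → (Solves2 u₁ u₂ s₂ ↔ IsMaximin2 u₂ s₂)) := by
  exact ⟨fun s₁ _ => solves1_iff_isMaximin1 hzs s₁, fun s₂ _ => solves2_iff_isMaximin2 hzs s₂⟩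
end

section
/- Consider the 2×2 game with action sets A_1 = A_2 = {x_1, x_2} and payoffs u_1(x_1,x_1) = 2, u_2(x_1,x_1) = 1, u_1(x_2,x_2) = 1, u_2(x_2,x_2) = 2, and u_1 = u_2 = 0 on the off-diagonal profiles. Then a mixed strategy s_1 solves player 1's Definition-4 problem if and only if s_1 is the pure strategy x_1 (the Dirac strategy on x_1), and a mixed strategy s_2 solves player 2's Definition-4 problem if and only if s_2 is the pure strategy x_2. -/
/-- Player 1's payoffs in the counterexample game of Figure 1. -/
noncomputable def cu₁ (a b : Fin 2) : ℝ :=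
  if a = 0 ∧ b = 0 then 2 else if a = 1 ∧ b = 1 then 1 else 0

/-- Player 2's payoffs in the counterexample game of Figure 1. -/
noncomputable def cu₂ (a b : Fin 2) : ℝ :=
  if a = 0 ∧ b = 0 then 1 else if a = 1 ∧ b = 1 then 2 else 0

theorem U_cu₁ (s t : Fin 2 → ℝ) : U cu₁ s t = 2 * (s 0 * t 0) + s 1 * t 1 := by
  simp [U, cu₁, Fin.sum_univ_two]
  ring

theorem U_cu₂ (s t : Fin 2 → ℝ) : U cu₂ s t = s 0 * t 0 + 2 * (s 1 * t 1) := by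
  simp [U, cu₂, Fin.sum_univ_two]
  ring

theorem isMixed_fin_two {s : Fin 2 → ℝ} :
    IsMixed s ↔ (0 ≤ s 0 ∧ 0 ≤ s 1) ∧ s 0 + s 1 = 1 := by
  simp [IsMixed, Fin.forall_fin_two, Fin.sum_univ_two]

theorem U_cu₁_le {s t : Fin 2 → ℝ} (hs : IsMixed s) (ht : IsMixed t) :
    U cu₁ s t ≤ 2 - s 1 := by
  rw [isMixed_fin_two] at hs ht
  rw [U_cu₁]
  have h₀ : s 0 * t 0 ≤ s 0 := mul_le_of_le_one_right hs.1.1 (by linarith)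
  have h₁ : s 1 * t 1 ≤ s 1 := mul_le_of_le_one_right hs.1.2 (by linarith)
  linarith

theorem U_cu₂_le {s t : Fin 2 → ℝ} (hs : IsMixed s) (ht : IsMixed t) :
    U cu₂ s t ≤ 2 - t 0 := by
  rw [isMixed_fin_two] at hs ht
  rw [U_cu₂]
  have h₀ : s 0 * t 0 ≤ t 0 := mul_le_of_le_one_left ht.1.1 (by linarith)
  have h₁ : s 1 * t 1 ≤ t 1 := mul_le_of_le_one_left ht.1.2 (by linarith)
  linarith

theorem isMixed_pureStrat (a : Fin 2) : IsMixed (pureStrat a) := by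
  fin_cases a <;> simp [isMixed_fin_two, pureStrat]

theorem isBR2_pureStrat_zero : IsBR2 cu₂ (pureStrat 0) (pureStrat 0) := by
  refine ⟨isMixed_pureStrat 0, fun t ht => ?_⟩
  rw [isMixed_fin_two] at ht
  simp only [U_cu₂, pureStrat]
  norm_num
  linarith

theorem isBR1_pureStrat_one : IsBR1 cu₁ (pureStrat 1) (pureStrat 1) := by
  refine ⟨isMixed_pureStrat 1, fun t ht => ?_⟩
  rw [isMixed_fin_two] at ht
  simp only [U_cu₁, pureStrat]
  norm_num
  linarith

theorem U_cu₁_pureStrat_zero : U cu₁ (pureStrat 0) (pureStrat 0) = 2 := by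
  simp [U_cu₁, pureStrat]

theorem U_cu₂_pureStrat_one : U cu₂ (pureStrat 1) (pureStrat 1) = 2 := by
  simp [U_cu₂, pureStrat]

/-- In the game of Figure 1 (with `x₁ = 0` and `x₂ = 1`), the unique solution of
player 1's Definition-4 problem is the pure strategy `x₁`, and the unique solution
of player 2's Definition-4 problem is the pure strategy `x₂`. -/
theorem def4_solutions_counterexample :
    (∀ s₁ : Fin 2 → ℝ, IsMixed s₁ → (Solves1 cu₁ cu₂ s₁ ↔ s₁ = pureStrat 0)) ∧
    (∀ s₂ : Fin 2 → ℝ, IsMixed s₂ → (Solves2 cu₁ cu₂ s₂ ↔ s₂ = pureStrat 1)) := by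
  refine ⟨fun s hs => ⟨?_, ?_⟩, fun s hs => ⟨?_, ?_⟩⟩
  · rintro ⟨-, t, ht, hmax⟩
    have h₂ := hmax _ _ (isMixed_pureStrat 0) isBR2_pureStrat_zero
    rw [U_cu₁_pureStrat_zero] at h₂
    have hle := U_cu₁_le hs ht.1
    rw [isMixed_fin_two] at hs
    ext a
    fin_cases a <;> simp [pureStrat] <;> linarith
  · rintro rfl
    refine ⟨hs, _, isBR2_pureStrat_zero, fun t t' ht ht' => ?_⟩
    rw [U_cu₁_pureStrat_zero]
    linarith [U_cu₁_le ht ht'.1, ht.1 1]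
  · rintro ⟨-, t, ht, hmax⟩
    have h₂ := hmax _ _ (isMixed_pureStrat 1) isBR1_pureStrat_one
    rw [U_cu₂_pureStrat_one] at h₂
    have hle := U_cu₂_le ht.1 hs
    rw [isMixed_fin_two] at hs
    ext a
    fin_cases a <;> simp [pureStrat] <;> linarith
  · rintro rfl
    refine ⟨hs, _, isBR1_pureStrat_one, fun t t' ht ht' => ?_⟩
    rw [U_cu₂_pureStrat_one]
    linarith [U_cu₂_le ht'.1 ht, ht.1 0]
end

section
/- Fix n ≥ 2 and consider the n-player game G_n in which every player j has action set A_j = {x_1, x_2}, players 1 and 2 have payoffs depending only on the actions (a_1, a_2) given by u_1(x_1,x_1) = 2, u_2(x_1,x_1) = 1, u_1(x_2,x_2) = 1, u_2(x_2,x_2) = 2, and u_1 = u_2 = 0 when a_1 ≠ a_2, and every player j with 3 ≤ j ≤ n has payoff u_j(a) = 1 if a_j = x_1 and u_j(a) = 0 otherwise (so x_1 is strictly dominant for these players). Then in G_n: any mixed strategy solving player 1's Definition-4 problem is the pure strategy x_1; any mixed strategy solving player 2's Definition-4 problem is the pure strategy x_2; and for every j with 3 ≤ j ≤ n, any mixed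 strategy solving player j's Definition-4 problem is the pure strategy x_1. -/
/-- Expected payoff of a mixed-strategy profile `t` under payoff function `u`. -/
noncomputable def UN {ι : Type*} [Fintype ι] [DecidableEq ι] {A : ι → Type*} [∀ i, Fintype (A i)]
    (u : (∀ i, A i) → ℝ) (t : ∀ i, A i → ℝ) : ℝ :=
  ∑ a : ∀ i, A i, (∏ i, t i (a i)) * u a

/-- `s` solves player `i`'s Definition-4 problem: player `i` is rational assuming that
every player `j ≠ i` is both rational and correct.  That is, there is a profile `t` with
`t i = s` in which every `t j` (`j ≠ i`) is a best response to `t₋ⱼ`, and `t` maximizes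
player `i`'s expected payoff among all such profiles. -/
def SolvesN {ι : Type*} [Fintype ι] [DecidableEq ι] {A : ι → Type*} [∀ i, Fintype (A i)]
    (u : ι → (∀ i, A i) → ℝ) (i : ι) (s : A i → ℝ) : Prop :=
  ∃ t : ∀ j, A j → ℝ, (∀ j, IsMixed (t j)) ∧ t i = s ∧
    (∀ j, j ≠ i → ∀ t' : A j → ℝ, IsMixed t' →
      UN (u j) (Function.update t j t') ≤ UN (u j) t) ∧
    (∀ t' : ∀ j, A j → ℝ, (∀ j, IsMixed (t' j)) →
      (∀ j, j ≠ i → ∀ t'' : A j → ℝ, IsMixed t'' →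
        UN (u j) (Function.update t' j t'') ≤ UN (u j) t') →
      UN (u i) t' ≤ UN (u i) t)

/-- Payoffs of the `n`-player game `G_n`: players `0` and `1` play the game of Figure 1
(their payoffs depend only on coordinates `0` and `1` of the action profile), and every
other player `j` gets payoff `1` if she plays `x₁ = 0` and `0` otherwise (so `x₁` is
strictly dominant for those players). -/
noncomputable def payoffGn (n : ℕ) (j : Fin n) (a : Fin n → Fin 2) : ℝ :=
  let a' : ℕ → Fin 2 := fun k => if h : k < n then a ⟨k, h⟩ else 0
  if (j : ℕ) = 0 then cu₁ (a' 0) (a' 1)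
  else if (j : ℕ) = 1 then cu₂ (a' 0) (a' 1)
  else if a j = 0 then 1 else 0

theorem UN_prod {ι : Type*} [Fintype ι] [DecidableEq ι] {A : ι → Type*} [∀ i, Fintype (A i)]
    (g t : ∀ i, A i → ℝ) :
    UN (fun a => ∏ i, g i (a i)) t = ∏ i, ∑ x, t i x * g i x := by
  rw [Finset.prod_univ_sum, Fintype.piFinset_univ]
  simp only [UN, Finset.prod_mul_distrib]

theorem UN_mul_of_ne {ι α : Type*} [Fintype ι] [DecidableEq ι] [Fintype α] {p q : ι} (hpq : p ≠ q)
    (f g : α → ℝ) {t : ι → α → ℝ} (ht : ∀ i, IsMixed (t i)) :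
    UN (A := fun _ => α) (fun a => f (a p) * g (a q)) t =
      (∑ x, t p x * f x) * ∑ x, t q x * g x := by
  have key := UN_prod (A := fun _ => α)
    (fun i x => (if i = p then f x else 1) * (if i = q then g x else 1)) t
  simp only [Finset.prod_mul_distrib, Finset.prod_ite_eq', Finset.mem_univ, if_true] at key
  rw [key, Fintype.prod_eq_mul p q hpq]
  · simp [hpq, hpq.symm]
  · rintro x ⟨hxp, hxq⟩
    simp [hxp, hxq, (ht x).2]

theorem UN_add {ι : Type*} [Fintype ι] [DecidableEq ι] {A : ι → Type*} [∀ i, Fintype (A i)]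
    (u v : (∀ i, A i) → ℝ) (t : ∀ i, A i → ℝ) :
    UN (fun a => u a + v a) t = UN u t + UN v t := by
  simp [UN, mul_add, Finset.sum_add_distrib]

theorem isMixed_pureStrat_s8 {α : Type*} [Fintype α] [DecidableEq α] (a : α) :
    IsMixed (pureStrat a) := by
  refine ⟨fun b => ?_, by simp [pureStrat]⟩
  unfold pureStrat
  split_ifs <;> norm_num

theorem IsMixed.update {ι : Type*} [DecidableEq ι] {A : ι → Type*} [∀ i, Fintype (A i)]
    {t : ∀ i, A i → ℝ} (ht : ∀ i, IsMixed (t i)) (j : ι) {s : A j → ℝ} (hs : IsMixed s) (i : ι) :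
    IsMixed (Function.update t j s i) := by
  by_cases h : i = j
  · subst h
    simpa using hs
  · simpa [Function.update_of_ne h] using ht i

theorem IsMixed.add_eq_one {s : Fin 2 → ℝ} (hs : IsMixed s) : s 0 + s 1 = 1 := by
  simpa using hs.2

theorem IsMixed.eq_pureStrat_zero {s : Fin 2 → ℝ} (hs : IsMixed s) (h : 1 ≤ s 0) :
    s = pureStrat 0 := by
  have := hs.1 1
  have := hs.add_eq_one
  ext i
  fin_cases i <;> simp [pureStrat] <;> linarith

theorem IsMixed.eq_pureStrat_one {s : Fin 2 → ℝ} (hs : IsMixed s) (h : 1 ≤ s 1) :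
    s = pureStrat 1 := by
  have := hs.1 0
  have := hs.add_eq_one
  ext i
  fin_cases i <;> simp [pureStrat] <;> linarith

theorem UN_payoffGn_first {n : ℕ} (h0 : 0 < n) (h1 : 1 < n) {t : Fin n → Fin 2 → ℝ}
    (ht : ∀ i, IsMixed (t i)) :
    UN (payoffGn n ⟨0, h0⟩) t =
      2 * (t ⟨0, h0⟩ 0 * t ⟨1, h1⟩ 0) + t ⟨0, h0⟩ 1 * t ⟨1, h1⟩ 1 := by
  have h : payoffGn n ⟨0, h0⟩ = fun a =>
      (if a ⟨0, h0⟩ = 0 then 2 else 0) * (if a ⟨1, h1⟩ = 0 then 1 else 0) +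
      (if a ⟨0, h0⟩ = 1 then 1 else 0) * (if a ⟨1, h1⟩ = 1 then 1 else 0) := by
    ext a
    simp only [payoffGn, cu₁, h0, h1, dif_pos, if_true]
    generalize a ⟨0, h0⟩ = x
    generalize a ⟨1, h1⟩ = y
    fin_cases x <;> fin_cases y <;> simp
  have hne : (⟨0, h0⟩ : Fin n) ≠ ⟨1, h1⟩ := by simp
  rw [h, UN_add,
    UN_mul_of_ne hne (fun x => if x = 0 then 2 else 0) (fun x => if x = 0 then 1 else 0) ht,
    UN_mul_of_ne hne (fun x => if x = 1 then 1 else 0) (fun x => if x = 1 then 1 else 0) ht]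
  simp
  ring

theorem UN_payoffGn_second {n : ℕ} (h0 : 0 < n) (h1 : 1 < n) {t : Fin n → Fin 2 → ℝ}
    (ht : ∀ i, IsMixed (t i)) :
    UN (payoffGn n ⟨1, h1⟩) t =
      t ⟨0, h0⟩ 0 * t ⟨1, h1⟩ 0 + 2 * (t ⟨0, h0⟩ 1 * t ⟨1, h1⟩ 1) := by
  have h : payoffGn n ⟨1, h1⟩ = fun a =>
      (if a ⟨0, h0⟩ = 0 then 1 else 0) * (if a ⟨1, h1⟩ = 0 then 1 else 0) +
      (if a ⟨0, h0⟩ = 1 then 2 else 0) * (if a ⟨1, h1⟩ = 1 then 1 else 0) := by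
    ext a
    simp only [payoffGn, cu₂, h0, h1, dif_pos, if_true, one_ne_zero, if_false]
    generalize a ⟨0, h0⟩ = x
    generalize a ⟨1, h1⟩ = y
    fin_cases x <;> fin_cases y <;> simp
  have hne : (⟨0, h0⟩ : Fin n) ≠ ⟨1, h1⟩ := by simp
  rw [h, UN_add,
    UN_mul_of_ne hne (fun x => if x = 0 then 1 else 0) (fun x => if x = 0 then 1 else 0) ht,
    UN_mul_of_ne hne (fun x => if x = 1 then 2 else 0) (fun x => if x = 1 then 1 else 0) ht]
  simp
  ring

theorem UN_payoffGn_of_two_le {n : ℕ} {j : Fin n} (hj : 2 ≤ (j : ℕ)) {t : Fin n → Fin 2 → ℝ}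
    (ht : ∀ i, IsMixed (t i)) : UN (payoffGn n j) t = t j 0 := by
  have hj0 : (j : ℕ) ≠ 0 := by omega
  have hj1 : (j : ℕ) ≠ 1 := by omega
  have h : payoffGn n j = fun a => (if a j = 0 then 1 else 0) * 1 := by
    ext a
    simp [payoffGn, hj0, hj1]
  have h0 : 0 < n := by omega
  have hne : j ≠ ⟨0, h0⟩ := fun h => hj0 (congrArg Fin.val h)
  rw [h, UN_mul_of_ne hne (fun x => if x = 0 then 1 else 0) (fun _ => 1) ht]
  have := (ht ⟨0, h0⟩).add_eq_one
  simp [this]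

/-- The profile of `G_n` in which the first two players coordinate on action `k` and every other
player plays `x₁`. -/
noncomputable def coordProfile (n : ℕ) (k : Fin 2) (i : Fin n) : Fin 2 → ℝ :=
  if (i : ℕ) < 2 then pureStrat k else pureStrat 0

theorem isMixed_coordProfile (n : ℕ) (k : Fin 2) (i : Fin n) : IsMixed (coordProfile n k i) := by
  unfold coordProfile
  split_ifs <;> exact isMixed_pureStrat_s8 _

/-- Coordinating on either action is a Nash equilibrium of `G_n`. -/
theorem coordProfile_bestResponse {n : ℕ} (hn : 2 ≤ n) (k : Fin 2) (j : Fin n) {s : Fin 2 → ℝ}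
    (hs : IsMixed s) :
    UN (payoffGn n j) (Function.update (coordProfile n k) j s) ≤
      UN (payoffGn n j) (coordProfile n k) := by
  have hc := isMixed_coordProfile n k
  have hu := IsMixed.update hc j hs
  have h0 := hs.1 0
  have h1 := hs.1 1
  have hsum := hs.add_eq_one
  have hn0 : 0 < n := by omega
  have hn1 : 1 < n := by omega
  obtain ⟨j, hj⟩ := j
  match j, hj with
  | 0, hj =>
    rw [UN_payoffGn_first hn0 hn1 hu, UN_payoffGn_first hn0 hn1 hc]
    fin_cases k <;> simp [coordProfile, pureStrat] <;> linarith
  | 1, hj =>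
    rw [UN_payoffGn_second hn0 hn1 hu, UN_payoffGn_second hn0 hn1 hc]
    fin_cases k <;> simp [coordProfile, pureStrat] <;> linarith
  | j + 2, hj =>
    rw [UN_payoffGn_of_two_le (by simp) hu, UN_payoffGn_of_two_le (by simp) hc]
    simp [coordProfile, pureStrat]
    linarith

/-- A solution of a Definition-4 problem in `G_n` is part of a profile that is at least as good
for the player concerned as coordination of the first two players on either action. -/
theorem SolvesN.exists_coordProfile_le {n : ℕ} (hn : 2 ≤ n) {i : Fin n} {s : Fin 2 → ℝ}
    (h : SolvesN (payoffGn n) i s) :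
    ∃ t : Fin n → Fin 2 → ℝ, (∀ j, IsMixed (t j)) ∧ t i = s ∧
      ∀ k, UN (payoffGn n i) (coordProfile n k) ≤ UN (payoffGn n i) t := by
  obtain ⟨t, ht, hti, -, hmax⟩ := h
  exact ⟨t, ht, hti, fun k => hmax _ (isMixed_coordProfile n k)
    fun j _ _ hs => coordProfile_bestResponse hn k j hs⟩

/-- In `G_n` (`n ≥ 2`): any solution of player 1's Definition-4 problem is the pure
strategy `x₁`, any solution of player 2's Definition-4 problem is the pure strategy
`x₂`, and for every other player any solution of her Definition-4 problem is the pure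
strategy `x₁`.  (Players are indexed from `0`, actions by `x₁ = 0`, `x₂ = 1`.) -/
theorem def4_solutions_Gn (n : ℕ) (hn : 2 ≤ n) :
    (∀ s : Fin 2 → ℝ, SolvesN (payoffGn n) ⟨0, by omega⟩ s → s = pureStrat 0) ∧
    (∀ s : Fin 2 → ℝ, SolvesN (payoffGn n) ⟨1, by omega⟩ s → s = pureStrat 1) ∧
    (∀ j : Fin n, 2 ≤ (j : ℕ) →
      ∀ s : Fin 2 → ℝ, SolvesN (payoffGn n) j s → s = pureStrat 0) := by
  have hn0 : 0 < n := by omega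
  have hn1 : 1 < n := by omega
  refine ⟨fun s h => ?_, fun s h => ?_, fun j hj s h => ?_⟩
  · obtain ⟨t, ht, rfl, hle⟩ := h.exists_coordProfile_le hn
    have hle := hle 0
    rw [UN_payoffGn_first hn0 hn1 (isMixed_coordProfile n 0), UN_payoffGn_first hn0 hn1 ht] at hle
    simp [coordProfile, pureStrat] at hle
    have hp := ht ⟨0, hn0⟩
    have hq := ht ⟨1, hn1⟩
    refine hp.eq_pureStrat_zero ?_
    nlinarith [hp.1 0, hp.1 1, hq.1 0, hq.1 1, hp.add_eq_one, hq.add_eq_one,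
      mul_nonneg (hp.1 0) (hq.1 1), mul_nonneg (hp.1 1) (hq.1 0)]
  · obtain ⟨t, ht, rfl, hle⟩ := h.exists_coordProfile_le hn
    have hle := hle 1
    rw [UN_payoffGn_second hn0 hn1 (isMixed_coordProfile n 1), UN_payoffGn_second hn0 hn1 ht] at hle
    simp [coordProfile, pureStrat] at hle
    have hp := ht ⟨0, hn0⟩
    have hq := ht ⟨1, hn1⟩
    refine hq.eq_pureStrat_one ?_
    nlinarith [hp.1 0, hp.1 1, hq.1 0, hq.1 1, hp.add_eq_one, hq.add_eq_one,
      mul_nonneg (hp.1 0) (hq.1 1), mul_nonneg (hp.1 1) (hq.1 0)]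
  · obtain ⟨t, ht, rfl, hle⟩ := h.exists_coordProfile_le hn
    have hle := hle 0
    rw [UN_payoffGn_of_two_le hj (isMixed_coordProfile n 0), UN_payoffGn_of_two_le hj ht] at hle
    refine (ht j).eq_pureStrat_zero ?_
    simpa [coordProfile, pureStrat] using hle
end
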